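/- Let y > 0, let d be a positive integer, let (Ω, F) be a measurable space, and let f : Ω × [0,y]^d → [0,y]^d be such that ω ↦ f(ω, x) is measurable for every fixed x ∈ [0,y]^d and x ↦ f(ω, x) is continuous for every fixed ω ∈ Ω. Then there exists a measurable map X* : Ω → [0,y]^d such that f(ω, X*(ω)) = X*(ω) for every ω ∈ Ω. (In particular, a random operator on the compact cube that is continuous in the state variable admits a measurable random fixed point.) -/

import Mathlib

open MeasureTheory

open Module Metric Set Filter Topology

section FixedPoint

variable {E : Type*}

theorem LinearMap.det_one_add_eq_sum_lagrange [AddCommGroup E] [Module ℝ E] [FiniteDimensional ℝ E]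
    (A : E →ₗ[ℝ] E) (s : Finset ℝ) (hs : finrank ℝ E < s.card) :
    LinearMap.det (1 + A) =
      ∑ t ∈ s, LinearMap.det (1 + t • A) * (Lagrange.basis s _root_.id t).eval 1 := by
  classical
  let b := finBasis ℝ E
  let p : Polynomial ℝ := Matrix.det ((Polynomial.X : Polynomial ℝ) •
    (LinearMap.toMatrix b b A).map Polynomial.C +
    (1 : Matrix (Fin (finrank ℝ E)) (Fin (finrank ℝ E)) ℝ).map Polynomial.C)
  have hp : ∀ t, p.eval t = LinearMap.det (1 + t • A) := by
    intro t
    rw [← LinearMap.det_toMatrix b, ← Polynomial.coe_evalRingHom, RingHom.map_det]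
    congr 1
    ext i j
    by_cases hij : i = j <;> simp [hij, LinearMap.toMatrix_one, mul_comm t, add_comm]
  have hdeg : p.degree < s.card := by
    have := Polynomial.natDegree_det_X_add_C_le (LinearMap.toMatrix b b A) 1
    rw [Fintype.card_fin] at this
    exact Polynomial.degree_le_natDegree.trans_lt (by exact_mod_cast this.trans_lt hs)
  have h1 := Lagrange.eq_interpolate (s := s) (v := _root_.id) (Set.injOn_id _) hdeg
  have h2 := congrArg (Polynomial.eval 1) h1
  rw [hp, one_smul, Lagrange.interpolate_apply, Polynomial.eval_finsetSum] at h2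
  refine h2.trans (Finset.sum_congr rfl fun t _ => ?_)
  rw [Polynomial.eval_mul, Polynomial.eval_C, hp, id_eq]

theorem exists_mem_segment_norm_eq [NormedAddCommGroup E] [NormedSpace ℝ E] {R : ℝ} {x y : E}
    (hx : ‖x‖ ≤ R) (hy : R ≤ ‖y‖) : ∃ z ∈ segment ℝ x y, ‖z‖ = R := by
  have h := (convex_segment (𝕜 := ℝ) x y).isPreconnected.intermediate_value
    (left_mem_segment ℝ x y) (right_mem_segment ℝ x y) continuous_norm.continuousOn
  exact h ⟨hx, hy⟩

/-- A Lipschitz map on a ball that vanishes on the sphere extends by zero to a Lipschitz map. -/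
theorem LipschitzOnWith.indicator_closedBall [NormedAddCommGroup E] [NormedSpace ℝ E]
    {K : NNReal} {R : ℝ} {u : E → E} (hu : LipschitzOnWith K u (closedBall 0 R))
    (h0 : ∀ x, ‖x‖ = R → u x = 0) : LipschitzWith K ((closedBall 0 R).indicator u) := by
  have key : ∀ x ∈ closedBall (0 : E) R, ∀ y ∉ closedBall (0 : E) R,
      dist (u x) 0 ≤ K * dist x y := by
    intro x hx y hy
    rw [mem_closedBall_zero_iff] at hx hy
    obtain ⟨z, hz, hzR⟩ := exists_mem_segment_norm_eq hx (not_le.1 hy).le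
    calc dist (u x) 0 = dist (u x) (u z) := by rw [h0 z hzR]
      _ ≤ K * dist x z := hu.dist_le_mul x (by simpa using hx) z (by simp [hzR])
      _ ≤ K * dist x y := by
        have := dist_add_dist_of_mem_segment hz
        gcongr
        linarith [dist_nonneg (x := z) (y := y)]
  refine LipschitzWith.of_dist_le_mul fun x y => ?_
  by_cases hx : x ∈ closedBall (0 : E) R <;> by_cases hy : y ∈ closedBall (0 : E) R
  · simpa [indicator_of_mem, hx, hy] using hu.dist_le_mul x hx y hy
  · rw [indicator_of_mem hx, indicator_of_notMem hy]
    exact key x hx y hy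
  · rw [indicator_of_notMem hx, indicator_of_mem hy, dist_comm, dist_comm x]
    exact key y hy x hx
  · rw [indicator_of_notMem hx, indicator_of_notMem hy, dist_self]
    positivity

theorem LipschitzWith.bijective_id_add [NormedAddCommGroup E] [CompleteSpace E]
    {K : NNReal} (hK : K < 1) {u : E → E} (hu : LipschitzWith K u) :
    Function.Bijective fun x => x + u x := by
  refine Function.bijective_iff_existsUnique _ |>.2 fun y => ?_
  have hc : ContractingWith K fun x => y - u x := by
    refine ⟨hK, LipschitzWith.of_dist_le_mul fun a b => ?_⟩
    rw [dist_sub_left]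
    exact hu.dist_le_mul a b
  refine ⟨hc.fixedPoint, ?_, fun x hx => hc.fixedPoint_unique ?_⟩
  · have : y - u hc.fixedPoint = hc.fixedPoint := hc.fixedPoint_isFixedPt
    exact (sub_eq_iff_eq_add.1 this).symm
  · exact sub_eq_iff_eq_add.2 hx.symm

section Normed

variable [NormedAddCommGroup E] [NormedSpace ℝ E]

theorem image_add_smul_closedBall [CompleteSpace E] {K : NNReal} {R t : ℝ} {u : E → E}
    (hu : LipschitzOnWith K u (closedBall 0 R)) (h0 : ∀ x, ‖x‖ = R → u x = 0)
    (hmaps : ∀ x ∈ closedBall (0 : E) R, x + u x ∈ closedBall (0 : E) R)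
    (ht0 : 0 ≤ t) (ht1 : t ≤ 1) (htK : t * K < 1) :
    InjOn (fun x => x + t • u x) (closedBall 0 R) ∧
      (fun x => x + t • u x) '' closedBall 0 R = closedBall 0 R := by
  let v := (closedBall (0 : E) R).indicator u
  have hv : LipschitzWith (t.toNNReal * K) fun x => t • v x := by
    refine LipschitzWith.of_dist_le_mul fun x y => ?_
    rw [dist_smul₀, Real.norm_of_nonneg ht0, NNReal.coe_mul, Real.coe_toNNReal _ ht0, mul_assoc]
    exact mul_le_mul_of_nonneg_left ((hu.indicator_closedBall h0).dist_le_mul x y) ht0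
  have hbij := hv.bijective_id_add (by
    rw [← NNReal.coe_lt_coe, NNReal.coe_mul, Real.coe_toNNReal _ ht0]; exact htK)
  have heq : EqOn (fun x => x + t • v x) (fun x => x + t • u x) (closedBall 0 R) := by
    intro x hx
    simp only [v, indicator_of_mem hx]
  refine ⟨(hbij.1.injOn).congr heq, Subset.antisymm ?_ fun y hy => ?_⟩
  · rintro _ ⟨x, hx, rfl⟩
    have := (convex_closedBall (0 : E) R) hx (hmaps x hx) (sub_nonneg.2 ht1) ht0 (by ring)
    convert this using 1
    module
  · obtain ⟨x, rfl⟩ := hbij.2 y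
    by_cases hx : x ∈ closedBall (0 : E) R
    · exact ⟨x, hx, (heq hx).symm⟩
    · simp only [v, indicator_of_notMem hx, smul_zero, add_zero] at hy
      exact absurd hy hx

theorem eventually_forall_det_one_add_smul_pos {s : Set E} (hs : IsCompact s)
    {A : E → E →L[ℝ] E} (hA : ContinuousOn A s) :
    ∀ᶠ t : ℝ in 𝓝 0, ∀ x ∈ s, 0 < (1 + t • A x).det := by
  obtain ⟨C, hC⟩ := hs.exists_bound_of_continuousOn hA
  have hopen : ∀ᶠ B : E →L[ℝ] E in 𝓝 0, 0 < (1 + B).det := by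
    have : Continuous fun B : E →L[ℝ] E => (1 + B).det :=
      ContinuousLinearMap.continuous_det.comp (continuous_const.add continuous_id)
    refine this.continuousAt.eventually (lt_mem_nhds ?_)
    simp [ContinuousLinearMap.det]
  obtain ⟨ε, hε, hball⟩ := Metric.eventually_nhds_iff.1 hopen
  have hlim : ∀ᶠ t : ℝ in 𝓝 0, |t| * C < ε := by
    have : Continuous fun t : ℝ => |t| * C := by fun_prop
    exact this.continuousAt.eventually (gt_mem_nhds (by simpa using hε))
  filter_upwards [hlim] with t ht x hx
  refine hball ?_
  rw [dist_zero_right, norm_smul, Real.norm_eq_abs]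
  exact (mul_le_mul_of_nonneg_left (hC x hx) (abs_nonneg t)).trans_lt ht

variable [FiniteDimensional ℝ E]

theorem setIntegral_det_one_add_fderiv [MeasurableSpace E] [BorelSpace E]
    (μ : Measure E) [μ.IsAddHaarMeasure] {R : ℝ} {u : E → E} (hu : ContDiff ℝ 1 u)
    (h0 : ∀ x, ‖x‖ = R → u x = 0)
    (hmaps : ∀ x ∈ closedBall (0 : E) R, x + u x ∈ closedBall (0 : E) R) :
    ∫ x in closedBall 0 R, (1 + fderiv ℝ u x).det ∂μ = μ.real (closedBall 0 R) := by
  have hcomp : IsCompact (closedBall (0 : E) R) := isCompact_closedBall 0 R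
  have hderiv : Continuous (fderiv ℝ u) := hu.continuous_fderiv one_ne_zero
  obtain ⟨K, hK⟩ := LocallyLipschitzOn.exists_lipschitzOnWith_of_compact hcomp
    (hu.locallyLipschitz.locallyLipschitzOn (s := closedBall 0 R))
  have hsmall : ∀ᶠ t : ℝ in 𝓝[>] 0,
      ∫ x in closedBall 0 R, (1 + t • fderiv ℝ u x).det ∂μ = μ.real (closedBall 0 R) := by
    have hK1 : ∀ᶠ t : ℝ in 𝓝 0, t * K < 1 := by
      have : Continuous fun t : ℝ => t * K := by fun_prop
      exact this.continuousAt.eventually (gt_mem_nhds (by simp))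
    filter_upwards [self_mem_nhdsWithin, nhdsWithin_le_nhds (gt_mem_nhds one_pos),
      nhdsWithin_le_nhds hK1, nhdsWithin_le_nhds
        (eventually_forall_det_one_add_smul_pos hcomp hderiv.continuousOn)]
      with t ht0 ht1 htK hpos
    obtain ⟨hinj, himg⟩ := image_add_smul_closedBall hK h0 hmaps (le_of_lt ht0) ht1.le htK
    have hfd : ∀ x ∈ closedBall (0 : E) R, HasFDerivWithinAt (fun x => x + t • u x)
        (1 + t • fderiv ℝ u x) (closedBall 0 R) x := fun x _ =>
      ((hasFDerivAt_id x).add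
        ((hu.differentiable one_ne_zero x).hasFDerivAt.const_smul t)).hasFDerivWithinAt
    have h := integral_image_eq_integral_abs_det_fderiv_smul μ measurableSet_closedBall hfd hinj
      fun _ => (1 : ℝ)
    rw [himg, setIntegral_const, smul_eq_mul, mul_one] at h
    rw [h]
    refine setIntegral_congr_fun measurableSet_closedBall fun x hx => ?_
    simp [abs_of_pos (hpos x hx)]
  obtain ⟨ε, hε, hε'⟩ := mem_nhdsGT_iff_exists_Ioo_subset.1 hsmall
  obtain ⟨s, hs, hcard⟩ := (Ioo_infinite (show (0 : ℝ) < ε from hε)).exists_subset_card_eq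
    (finrank ℝ E + 1)
  have hsum : ∀ x, (1 + fderiv ℝ u x).det =
      ∑ t ∈ s, (1 + t • fderiv ℝ u x).det * (Lagrange.basis s id t).eval 1 := fun x =>
    LinearMap.det_one_add_eq_sum_lagrange (fderiv ℝ u x : E →ₗ[ℝ] E) s (by omega)
  simp_rw [hsum]
  rw [integral_finsetSum]
  · have hbasis : ∑ t ∈ s, (Lagrange.basis s id t).eval (1 : ℝ) = 1 := by
      rw [← Polynomial.eval_finsetSum, Lagrange.sum_basis (Set.injOn_id _)
        (Finset.card_pos.1 (by omega)), Polynomial.eval_one]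
    calc _ = ∑ t ∈ s, μ.real (closedBall 0 R) * (Lagrange.basis s id t).eval 1 :=
          Finset.sum_congr rfl fun t ht => by
            rw [integral_mul_const, show (∫ x in closedBall 0 R, (1 + t • fderiv ℝ u x).det ∂μ) =
              μ.real (closedBall 0 R) from hε' (hs ht)]
      _ = _ := by rw [← Finset.mul_sum, hbasis, mul_one]
  · intro t _
    refine ContinuousOn.integrableOn_compact hcomp (Continuous.continuousOn ?_)
    exact (ContinuousLinearMap.continuous_det.comp
      (continuous_const.add (hderiv.const_smul t))).mul continuous_const

end Normed

section Brouwer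

variable [NormedAddCommGroup E] [InnerProductSpace ℝ E] [FiniteDimensional ℝ E]

theorem det_fderiv_eq_zero_of_norm_eq {r : E → E} {x : E} {R : ℝ} (hR : 0 < R)
    (hr : DifferentiableAt ℝ r x) (hn : ∀ z, ‖r z‖ = R) : (fderiv ℝ r x).det = 0 := by
  have hinner : ∀ v, inner ℝ (r x) (fderiv ℝ r x v) = 0 := by
    intro v
    have h1 := hr.hasFDerivAt.norm_sq
    have h2 : HasFDerivAt (fun z => ‖r z‖ ^ 2) (0 : E →L[ℝ] ℝ) x := by
      simp_rw [hn]
      exact hasFDerivAt_const _ _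
    simpa using congrArg (fun L : E →L[ℝ] ℝ => L v) (h1.unique h2)
  by_contra hdet
  obtain ⟨v, hv⟩ := ((fderiv ℝ r x : E →ₗ[ℝ] E).equivOfDetNeZero hdet).surjective (r x)
  have hv' : fderiv ℝ r x v = r x := hv
  have := hinner v
  rw [hv', real_inner_self_eq_norm_sq, hn] at this
  exact (pow_pos hR 2).ne' this

/-- There is no continuously differentiable retraction onto a sphere. -/
theorem not_exists_contDiff_retraction_sphere {R : ℝ} (hR : 0 < R) {r : E → E}
    (hr : ContDiff ℝ 1 r) (hn : ∀ x, ‖r x‖ = R) (hid : ∀ x, ‖x‖ = R → r x = x) : False := by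
  borelize E
  have hu : ContDiff ℝ 1 fun x => r x - x := hr.sub contDiff_id
  have h := setIntegral_det_one_add_fderiv (Measure.addHaar : Measure E) (R := R) hu
    (fun x hx => by rw [hid x hx, sub_self]) fun x _ => by simp [hn]
  have hzero : ∀ x, (1 + fderiv ℝ (fun x => r x - x) x).det = 0 := by
    intro x
    have hd := hr.differentiable one_ne_zero x
    rw [fderiv_fun_sub hd differentiableAt_fun_id, fderiv_fun_id]
    rw [← det_fderiv_eq_zero_of_norm_eq hR hd hn]
    congr 1
    exact add_sub_cancel _ _
  simp_rw [hzero, integral_zero] at h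
  exact (ENNReal.toReal_pos (measure_closedBall_pos _ _ hR).ne'
    measure_closedBall_lt_top.ne).ne h

/-- A continuous self-map of a Euclidean space that is the identity near infinity has a zero. -/
theorem exists_eq_zero_of_eq_self_of_lt_norm {F : E → E} (hF : Continuous F) {R : ℝ}
    (hR : 0 ≤ R) (hid : ∀ x, R < ‖x‖ → F x = x) : ∃ x, F x = 0 := by
  by_contra! hne
  have hR1 : 0 < R + 1 := by linarith
  have hU : IsOpen {x : E | R < ‖x‖} := isOpen_lt continuous_const continuous_norm
  obtain ⟨G, hG, hGF, hGid, -⟩ := hF.exists_contDiff_approx_and_eqOn 1 hF.norm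
    (fun x => norm_pos_iff.2 (hne x)) (S := {x : E | R + 1 ≤ ‖x‖})
    (isClosed_le continuous_const continuous_norm)
    (hU.mem_nhdsSet.2 fun x (hx : R + 1 ≤ ‖x‖) => show R < ‖x‖ by linarith)
    (contDiffOn_id.congr hid)
  have hG0 : ∀ x, G x ≠ 0 := by
    intro x hx
    have := hGF x
    rw [hx, dist_zero_left] at this
    exact lt_irrefl _ this
  refine not_exists_contDiff_retraction_sphere (r := fun x => ((R + 1) / ‖G x‖) • G x) hR1
    ((contDiff_const.div (ContDiff.norm ℝ hG hG0) fun x => norm_ne_zero_iff.2 (hG0 x)).smul hG)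
    (fun x => ?_) fun x hx => ?_
  · rw [norm_smul, norm_div, norm_norm, Real.norm_of_nonneg hR1.le,
      div_mul_cancel₀ _ (norm_ne_zero_iff.2 (hG0 x))]
  · have : G x = x := (hGid hx.ge).trans (hid x (by linarith))
    simp only [this, hx]
    rw [div_self hR1.ne', one_smul]

/-- **Brouwer's fixed point theorem** for bounded continuous self-maps of a Euclidean space. -/
theorem Continuous.exists_isFixedPt_of_norm_le {h : E → E} (hh : Continuous h) {M : ℝ}
    (hM : ∀ x, ‖h x‖ ≤ M) : ∃ x, h x = x := by
  have hM0 : 0 ≤ M := (norm_nonneg _).trans (hM 0)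
  let c : E → ℝ := fun x => max 0 (min 1 (M + 1 - ‖x‖))
  have hc0 : ∀ x, 0 ≤ c x := fun x => le_max_left _ _
  have hc1 : ∀ x, c x ≤ 1 := fun x => max_le zero_le_one (min_le_left _ _)
  obtain ⟨x, hx⟩ := exists_eq_zero_of_eq_self_of_lt_norm (F := fun x => x - c x • h x) (R := M + 1)
    (by fun_prop) (by linarith) fun x hx => by
      have : c x = 0 := max_eq_left ((min_le_right _ _).trans (by linarith))
      rw [this, zero_smul, sub_zero]
  have hx' : x = c x • h x := sub_eq_zero.1 hx
  have hxM : ‖x‖ ≤ M := by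
    rw [hx', norm_smul, Real.norm_of_nonneg (hc0 x)]
    exact (mul_le_of_le_one_left (norm_nonneg _) (hc1 x)).trans (hM x)
  have hcx : c x = 1 := by
    simp only [c]
    rw [min_eq_left (by linarith), max_eq_right zero_le_one]
  rw [hcx, one_smul] at hx'
  exact ⟨x, hx'.symm⟩

end Brouwer

end FixedPoint

/-- **Brouwer's fixed point theorem** for cubes. -/
theorem Continuous.exists_isFixedPt_pi_Icc {ι : Type*} [Fintype ι] {y : ℝ} (hy : 0 ≤ y)
    {f : (ι → Icc (0 : ℝ) y) → (ι → Icc (0 : ℝ) y)} (hf : Continuous f) : ∃ x, f x = x := by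
  let p : EuclideanSpace ℝ ι → (ι → Icc (0 : ℝ) y) := fun x i => projIcc 0 y hy (x i)
  let e : (ι → Icc (0 : ℝ) y) → EuclideanSpace ℝ ι := fun x => WithLp.toLp 2 fun i => (x i : ℝ)
  have hp : Continuous p := continuous_pi fun i => continuous_projIcc.comp (by fun_prop)
  have he : Continuous e := by fun_prop
  have hpe : ∀ x, p (e x) = x := fun x => funext fun i => projIcc_val hy (x i)
  obtain ⟨M, hM⟩ := isCompact_univ.exists_bound_of_continuousOn he.continuousOn
  obtain ⟨x, hx⟩ := Continuous.exists_isFixedPt_of_norm_le (h := e ∘ f ∘ p)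
    (he.comp (hf.comp hp)) fun x => hM (f (p x)) (mem_univ _)
  refine ⟨p x, ?_⟩
  conv_rhs => rw [← hx]
  exact (hpe _).symm

section Selection

variable {Ω K : Type*} [MeasurableSpace Ω] [TopologicalSpace K] {φ : Ω → K → ℝ}

theorem measurableSet_exists_mem_eq_zero [SecondCountableTopology K]
    (hmeas : ∀ x, Measurable fun ω => φ ω x) (hcont : ∀ ω, Continuous (φ ω))
    (hnonneg : ∀ ω x, 0 ≤ φ ω x) {C : Set K} (hC : IsCompact C) :
    MeasurableSet {ω | ∃ x ∈ C, φ ω x = 0} := by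
  obtain ⟨D, hDc, hDd⟩ := TopologicalSpace.exists_countable_dense C
  have heq : {ω | ∃ x ∈ C, φ ω x = 0} =
      ⋂ n : ℕ, ⋃ x ∈ D, {ω | φ ω x < 1 / ((n : ℝ) + 1)} := by
    ext ω
    simp only [mem_ofPred_eq, mem_iInter, mem_iUnion]
    constructor
    · rintro ⟨x, hx, h0⟩ n
      have hopen : IsOpen {z : C | φ ω z < 1 / ((n : ℝ) + 1)} :=
        isOpen_lt ((hcont ω).comp continuous_subtype_val) continuous_const
      obtain ⟨z, hz, hzD⟩ := hDd.exists_mem_open hopen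
        ⟨⟨x, hx⟩, by simp only [mem_ofPred_eq, h0]; positivity⟩
      exact ⟨z, hz, hzD⟩
    · intro h
      obtain ⟨z, -, -⟩ := h 0
      obtain ⟨x, hx, hmin⟩ := hC.exists_isMinOn ⟨z, z.2⟩ (hcont ω).continuousOn
      refine ⟨x, hx, le_antisymm (le_of_forall_pos_le_add fun ε hε => ?_) (hnonneg ω x)⟩
      obtain ⟨n, hn⟩ := exists_nat_one_div_lt hε
      obtain ⟨w, -, hw⟩ := h n
      rw [zero_add]
      exact (hmin w.2).trans (hw.trans hn).le
  rw [heq]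
  exact MeasurableSet.iInter fun n => MeasurableSet.biUnion hDc fun x _ =>
    measurableSet_lt (hmeas x) measurable_const

variable [CompactSpace K] [SecondCountableTopology K]

theorem exists_measurable_eq_on_zeros (hmeas : ∀ x, Measurable fun ω => φ ω x)
    (hcont : ∀ ω, Continuous (φ ω)) (hnonneg : ∀ ω x, 0 ≤ φ ω x) (hex : ∀ ω, ∃ x, φ ω x = 0)
    {h : K → ℝ} (hh : Continuous h) :
    ∃ m : Ω → ℝ, Measurable m ∧ ∀ ω, ∃ x, φ ω x = 0 ∧ h x = m ω := by
  have hmin : ∀ ω, ∃ x, φ ω x = 0 ∧ ∀ z, φ ω z = 0 → h x ≤ h z := by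
    intro ω
    obtain ⟨x, hx, hmin⟩ := (isClosed_eq (hcont ω) continuous_const).isCompact.exists_isMinOn
      (hex ω) hh.continuousOn
    exact ⟨x, hx, fun z hz => hmin hz⟩
  choose x hx hxmin using hmin
  refine ⟨fun ω => h (x ω), measurable_of_Iic fun c => ?_, fun ω => ⟨x ω, hx ω, rfl⟩⟩
  convert measurableSet_exists_mem_eq_zero hmeas hcont hnonneg
    (isClosed_le hh (continuous_const (y := c))).isCompact using 1
  ext ω
  exact ⟨fun hω => ⟨x ω, hω, hx ω⟩, fun ⟨z, hz, hz0⟩ => (hxmin ω z hz0).trans hz⟩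

theorem exists_measurable_forall_mem_eq_on_zeros (hmeas : ∀ x, Measurable fun ω => φ ω x)
    (hcont : ∀ ω, Continuous (φ ω)) (hnonneg : ∀ ω x, 0 ≤ φ ω x) (hex : ∀ ω, ∃ x, φ ω x = 0)
    {ι : Type*} {h : ι → K → ℝ} (hh : ∀ i, Continuous (h i)) (s : Finset ι) :
    ∃ m : ι → Ω → ℝ, (∀ i, Measurable (m i)) ∧
      ∀ ω, ∃ x, φ ω x = 0 ∧ ∀ i ∈ s, h i x = m i ω := by
  classical
  induction s using Finset.induction_on with
  | empty => exact ⟨fun _ _ => 0, fun _ => measurable_const, by simpa using hex⟩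
  | insert j s hj ih =>
    obtain ⟨m, hm, hms⟩ := ih
    have hzero : ∀ ω x, φ ω x + ∑ i ∈ s, |h i x - m i ω| = 0 ↔
        φ ω x = 0 ∧ ∀ i ∈ s, h i x = m i ω := by
      intro ω x
      rw [add_eq_zero_iff_of_nonneg (hnonneg ω x) (Finset.sum_nonneg fun _ _ => abs_nonneg _),
        Finset.sum_eq_zero_iff_of_nonneg fun _ _ => abs_nonneg _]
      simp only [abs_eq_zero, sub_eq_zero]
    obtain ⟨n, hn, hns⟩ := exists_measurable_eq_on_zeros
      (φ := fun ω x => φ ω x + ∑ i ∈ s, |h i x - m i ω|)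
      (fun x => (hmeas x).add (Finset.measurable_fun_sum s fun i _ =>
        (measurable_const.sub (hm i)).abs))
      (fun ω => by fun_prop)
      (fun ω x => add_nonneg (hnonneg ω x) (Finset.sum_nonneg fun _ _ => abs_nonneg _))
      (fun ω => (hms ω).imp fun x => (hzero ω x).2) (hh j)
    refine ⟨Function.update m j n, fun i => ?_, fun ω => ?_⟩
    · rcases eq_or_ne i j with rfl | hij
      · rwa [Function.update_self]
      · rw [Function.update_of_ne hij]
        exact hm i
    · obtain ⟨x, hx, hxj⟩ := hns ω
      obtain ⟨hx0, hxs⟩ := (hzero ω x).1 hx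
      refine ⟨x, hx0, fun i hi => ?_⟩
      rcases Finset.mem_insert.1 hi with rfl | hi
      · rw [Function.update_self, hxj]
      · rw [Function.update_of_ne (ne_of_mem_of_not_mem hi hj), hxs i hi]

end Selection

/-- **Random fixed point theorem for Carathéodory maps of the cube.**
Let `y > 0`, let `d` be a positive integer, let `(Ω, F)` be a measurable space, and let
`f : Ω × [0,y]^d → [0,y]^d` be measurable in `ω` for every fixed `x ∈ [0,y]^d` and
continuous in `x` for every fixed `ω`.  Then there is a measurable map
`X* : Ω → [0,y]^d` with `f(ω, X*(ω)) = X*(ω)` for every `ω`. -/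
theorem random_fixed_point_of_caratheodory
    {Ω : Type*} [MeasurableSpace Ω] (y : ℝ) (hy : 0 < y) (d : ℕ) (hd : 0 < d)
    (f : Ω → (Fin d → Set.Icc (0 : ℝ) y) → (Fin d → Set.Icc (0 : ℝ) y))
    (hmeas : ∀ x, Measurable fun ω => f ω x)
    (hcont : ∀ ω, Continuous (f ω)) :
    ∃ X : Ω → (Fin d → Set.Icc (0 : ℝ) y),
      Measurable X ∧ ∀ ω, f ω (X ω) = X ω := by
  obtain ⟨m, hm, hms⟩ := exists_measurable_forall_mem_eq_on_zeros
    (φ := fun ω x => dist (f ω x) x) (fun x => (hmeas x).dist measurable_const)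
    (fun ω => (hcont ω).dist continuous_id) (fun _ _ => dist_nonneg)
    (fun ω => by simpa only [dist_eq_zero] using (hcont ω).exists_isFixedPt_pi_Icc hy.le)
    (h := fun i x => (x i : ℝ)) (fun i => by fun_prop) Finset.univ
  choose X hX hXm using hms
  refine ⟨X, measurable_pi_iff.2 fun i => ?_, fun ω => dist_eq_zero.1 (hX ω)⟩
  rw [← MeasurableEmbedding.measurable_comp_iff (.subtype_coe measurableSet_Icc)]
  convert hm i using 1
  exact funext fun ω => hXm ω i (Finset.mem_univ i)
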